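/- Let p ≥ 1, let P be a p×p real orthogonal matrix, let D = diag(σ₁, …, σ_p) with all σₖ > 0, and let M be a p×p real symmetric positive definite matrix. Set Σ = Pᵀ D² P and Σ̂ = Pᵀ D M D P, and let 𝟙 ∈ ℝᵖ be the all-ones vector. Define the free optimal weights S_Σ = Σ⁻¹𝟙 and S_Σ̂ = Σ̂⁻¹𝟙. Then, with σ_max = maxₖ σₖ and σ_min = minₖ σₖ and ‖·‖₂ denoting the Euclidean norm on vectors and the induced operator norm on matrices, ‖S_Σ − S_Σ̂‖₂ ≤ ‖S_Σ‖₂ · (σ_max / σ_min) · ‖I − M⁻¹‖₂. -/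

import Mathlib

open Matrix

/-- The Euclidean (ℓ²) norm of a vector in `ℝᵖ`. -/
noncomputable def euclideanNorm {p : ℕ} (x : Fin p → ℝ) : ℝ :=
  ‖(WithLp.equiv 2 (Fin p → ℝ)).symm x‖

/-- The operator (spectral) norm of a matrix, induced by the Euclidean norm. -/
noncomputable def l2OpNorm {p : ℕ} (A : Matrix (Fin p) (Fin p) ℝ) : ℝ :=
  ‖Matrix.toEuclideanCLM (𝕜 := ℝ) A‖

theorem l2OpNorm_nonneg {p : ℕ} (A : Matrix (Fin p) (Fin p) ℝ) : 0 ≤ l2OpNorm A :=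
  norm_nonneg _

theorem l2OpNorm_mul_le {p : ℕ} (A B : Matrix (Fin p) (Fin p) ℝ) :
    l2OpNorm (A * B) ≤ l2OpNorm A * l2OpNorm B := by
  unfold l2OpNorm
  rw [map_mul]
  exact norm_mul_le _ _

theorem euclideanNorm_mulVec_le {p : ℕ} (A : Matrix (Fin p) (Fin p) ℝ) (x : Fin p → ℝ) :
    euclideanNorm (A *ᵥ x) ≤ l2OpNorm A * euclideanNorm x :=
  (Matrix.toEuclideanCLM (𝕜 := ℝ) A).le_opNorm (WithLp.toLp 2 x)

theorem euclideanNorm_sq {p : ℕ} (x : Fin p → ℝ) : euclideanNorm x ^ 2 = x ⬝ᵥ x := by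
  simp [euclideanNorm, EuclideanSpace.norm_sq_eq, dotProduct, ← sq]

theorem l2OpNorm_le_of_forall_sq_le {p : ℕ} (A : Matrix (Fin p) (Fin p) ℝ) {c : ℝ} (hc : 0 ≤ c)
    (h : ∀ x : Fin p → ℝ, (A *ᵥ x) ⬝ᵥ (A *ᵥ x) ≤ c ^ 2 * (x ⬝ᵥ x)) : l2OpNorm A ≤ c := by
  refine ContinuousLinearMap.opNorm_le_bound _ hc fun x => ?_
  change euclideanNorm (A *ᵥ x.ofLp) ≤ c * euclideanNorm x.ofLp
  refine le_of_sq_le_sq ?_ (mul_nonneg hc (norm_nonneg _))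
  rw [mul_pow, euclideanNorm_sq, euclideanNorm_sq]
  exact h x.ofLp

theorem l2OpNorm_le_one_of_transpose_mul_self {p : ℕ} {P : Matrix (Fin p) (Fin p) ℝ}
    (hP : Pᵀ * P = 1) : l2OpNorm P ≤ 1 := by
  refine l2OpNorm_le_of_forall_sq_le P zero_le_one fun x => ?_
  rw [Matrix.dotProduct_mulVec, Matrix.vecMul_mulVec, ← Matrix.dotProduct_mulVec, hP]
  simp

theorem l2OpNorm_diagonal_le {p : ℕ} {d : Fin p → ℝ} {c : ℝ} (hc : 0 ≤ c)
    (hd : ∀ i, |d i| ≤ c) : l2OpNorm (Matrix.diagonal d) ≤ c := by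
  refine l2OpNorm_le_of_forall_sq_le _ hc fun x => ?_
  simp only [dotProduct, Matrix.mulVec_diagonal, Finset.mul_sum]
  refine Finset.sum_le_sum fun i _ => ?_
  have h := sq_le_sq' (neg_le_of_abs_le (hd i)) (le_of_abs_le (hd i))
  nlinarith [mul_le_mul_of_nonneg_right h (sq_nonneg (x i))]

theorem free_weight_error_bound (p : ℕ) (hp : 1 ≤ p)
    (P : Matrix (Fin p) (Fin p) ℝ) (hP : Pᵀ * P = 1)
    (σ : Fin p → ℝ) (hσ : ∀ k, 0 < σ k)
    (D : Matrix (Fin p) (Fin p) ℝ) (hD : D = Matrix.diagonal σ)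
    (M : Matrix (Fin p) (Fin p) ℝ) (hM : M.PosDef)
    (Cov CovHat : Matrix (Fin p) (Fin p) ℝ)
    (hCov : Cov = Pᵀ * D ^ 2 * P) (hCovHat : CovHat = Pᵀ * D * M * D * P)
    (SCov SCovHat : Fin p → ℝ)
    (hS : SCov = Cov⁻¹ *ᵥ (1 : Fin p → ℝ))
    (hShat : SCovHat = CovHat⁻¹ *ᵥ (1 : Fin p → ℝ))
    (σmax σmin : ℝ)
    (hσmax : IsGreatest (Set.range σ) σmax) (hσmin : IsLeast (Set.range σ) σmin) :
    euclideanNorm (SCov - SCovHat) ≤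
      euclideanNorm SCov * (σmax / σmin) * l2OpNorm (1 - M⁻¹) := by
  have hP' : P * Pᵀ = 1 := mul_eq_one_comm.mp hP
  have hmax : ∀ k, σ k ≤ σmax := fun k => hσmax.2 ⟨k, rfl⟩
  have hmin : ∀ k, σmin ≤ σ k := fun k => hσmin.2 ⟨k, rfl⟩
  have hmin0 : 0 < σmin := by
    obtain ⟨k, rfl⟩ := hσmin.1
    exact hσ k
  have hmax0 : 0 < σmax := by
    obtain ⟨k, rfl⟩ := hσmax.1
    exact hσ k
  obtain ⟨E, hE⟩ : ∃ E, E = Matrix.diagonal fun k => (σ k)⁻¹ := ⟨_, rfl⟩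
  have hDE : D * E = 1 := by
    rw [hD, hE, Matrix.diagonal_mul_diagonal, ← Matrix.diagonal_one]
    congr 1
    funext k
    exact mul_inv_cancel₀ (hσ k).ne'
  have hED : E * D = 1 := mul_eq_one_comm.mp hDE
  have hMM : M * M⁻¹ = 1 := Matrix.mul_nonsing_inv M ((Matrix.isUnit_iff_isUnit_det M).mp hM.isUnit)
  have cancel {A B : Matrix (Fin p) (Fin p) ℝ} (h : A * B = 1)
      (X : Matrix (Fin p) (Fin p) ℝ) : A * (B * X) = X := by
    rw [← Matrix.mul_assoc, h, Matrix.one_mul]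
  have hCovInv : Cov⁻¹ = Pᵀ * E * E * P := by
    refine Matrix.inv_eq_right_inv ?_
    simp only [hCov, sq, Matrix.mul_assoc, cancel hP', cancel hDE, hP]
  have hCovHatInv : CovHat⁻¹ = Pᵀ * E * M⁻¹ * E * P := by
    refine Matrix.inv_eq_right_inv ?_
    simp only [hCovHat, Matrix.mul_assoc, cancel hP', cancel hDE, cancel hMM, hP]
  have hdiff : SCov - SCovHat = (Pᵀ * E * (1 - M⁻¹) * D * P) *ᵥ SCov := by
    rw [hS, hShat, Matrix.mulVec_mulVec, ← Matrix.sub_mulVec, hCovInv, hCovHatInv]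
    congr 1
    simp only [Matrix.mul_assoc, cancel hP', cancel hDE, Matrix.sub_mul, Matrix.mul_sub,
      Matrix.one_mul]
  have hPn : l2OpNorm P ≤ 1 := l2OpNorm_le_one_of_transpose_mul_self hP
  have hPtn : l2OpNorm Pᵀ ≤ 1 :=
    l2OpNorm_le_one_of_transpose_mul_self (by rwa [Matrix.transpose_transpose])
  have hDn : l2OpNorm D ≤ σmax := by
    rw [hD]
    exact l2OpNorm_diagonal_le hmax0.le fun k => by rw [abs_of_pos (hσ k)]; exact hmax k
  have hEn : l2OpNorm E ≤ σmin⁻¹ := by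
    rw [hE]
    refine l2OpNorm_diagonal_le (inv_nonneg.mpr hmin0.le) fun k => ?_
    rw [abs_of_pos (inv_pos.mpr (hσ k))]
    exact inv_anti₀ hmin0 (hmin k)
  have hop : l2OpNorm (Pᵀ * E * (1 - M⁻¹) * D * P) ≤
      1 * σmin⁻¹ * l2OpNorm (1 - M⁻¹) * σmax * 1 := by
    have hstep {A B : Matrix (Fin p) (Fin p) ℝ} {a b : ℝ} (ha : l2OpNorm A ≤ a)
        (hb : l2OpNorm B ≤ b) : l2OpNorm (A * B) ≤ a * b :=
      (l2OpNorm_mul_le A B).trans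
        (mul_le_mul ha hb (l2OpNorm_nonneg B) ((l2OpNorm_nonneg A).trans ha))
    exact hstep (hstep (hstep (hstep hPtn hEn) le_rfl) hDn) hPn
  calc euclideanNorm (SCov - SCovHat)
      ≤ l2OpNorm (Pᵀ * E * (1 - M⁻¹) * D * P) * euclideanNorm SCov := by
        rw [hdiff]
        exact euclideanNorm_mulVec_le _ _
    _ ≤ (1 * σmin⁻¹ * l2OpNorm (1 - M⁻¹) * σmax * 1) * euclideanNorm SCov :=
        mul_le_mul_of_nonneg_right hop (norm_nonneg _)
    _ = euclideanNorm SCov * (σmax / σmin) * l2OpNorm (1 - M⁻¹) := by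
        rw [div_eq_mul_inv]
        ring
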